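/- arXiv:2503.08554 — 8 statements merged into one kernel-verified Lean document; each statement's English description precedes it below -/
import Mathlib

section
/- For every φ > 0, d ≥ 0, D_W > 0 and D_L > 0, the double average (1/(D_W·D_L))·∫_{−D_L/2}^{D_L/2} ∫_{−D_W/2}^{D_W/2} e^{−φ·√(x² + y² + d²)} dy dx is strictly less than the single average (1/D_W)·∫_{−D_W/2}^{D_W/2} e^{−φ·√(y² + d²)} dy. Consequently the high-SNR outage probability of the pinching-antenna system, 1 − (1/D_W)∫_{−D_W/2}^{D_W/2} e^{−φ√(y²+d²)} dy, is strictly smaller than that of the conventional-antenna system, 1 − (1/(D_W D_L))∫_{−D_L/2}^{D_L/2}∫_{−D_W/2}^{D_W/2} e^{−φ√(x²+y²+d²)} dy dx. -/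
open Real MeasureTheory intervalIntegral

/-- For every φ > 0, d ≥ 0, D_W > 0 and D_L > 0, the double average of
e^{−φ√(x²+y²+d²)} over the rectangle is strictly less than the single average of
e^{−φ√(y²+d²)}; consequently the high-SNR outage probability of the pinching-antenna
system is strictly smaller than that of the conventional-antenna system. -/
theorem stmt_1 (φ d DW DL : ℝ) (hφ : 0 < φ) (hd : 0 ≤ d) (hDW : 0 < DW) (hDL : 0 < DL) :
    ((1 / (DW * DL)) *
        ∫ x in (-(DL / 2))..(DL / 2), ∫ y in (-(DW / 2))..(DW / 2),
          Real.exp (-φ * Real.sqrt (x ^ 2 + y ^ 2 + d ^ 2)) <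
      (1 / DW) * ∫ y in (-(DW / 2))..(DW / 2), Real.exp (-φ * Real.sqrt (y ^ 2 + d ^ 2))) ∧
    (1 - (1 / DW) * ∫ y in (-(DW / 2))..(DW / 2), Real.exp (-φ * Real.sqrt (y ^ 2 + d ^ 2)) <
      1 - (1 / (DW * DL)) *
        ∫ x in (-(DL / 2))..(DL / 2), ∫ y in (-(DW / 2))..(DW / 2),
          Real.exp (-φ * Real.sqrt (x ^ 2 + y ^ 2 + d ^ 2))) := by
  have hc : Continuous (fun p : ℝ × ℝ =>
      Real.exp (-φ * Real.sqrt (p.1 ^ 2 + p.2 ^ 2 + d ^ 2))) := by fun_prop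
  have hc0 : Continuous (fun y : ℝ => Real.exp (-φ * Real.sqrt (y ^ 2 + d ^ 2))) := by fun_prop
  have hcx : ∀ x : ℝ, Continuous (fun y : ℝ =>
      Real.exp (-φ * Real.sqrt (x ^ 2 + y ^ 2 + d ^ 2))) := by intro x; fun_prop
  have hle : ∀ x y : ℝ, Real.exp (-φ * Real.sqrt (x ^ 2 + y ^ 2 + d ^ 2)) ≤
      Real.exp (-φ * Real.sqrt (y ^ 2 + d ^ 2)) := by
    intro x y
    apply Real.exp_le_exp.mpr
    have : Real.sqrt (y ^ 2 + d ^ 2) ≤ Real.sqrt (x ^ 2 + y ^ 2 + d ^ 2) :=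
      Real.sqrt_le_sqrt (by nlinarith [sq_nonneg x])
    nlinarith
  have hlt : ∀ x y : ℝ, 0 < x → Real.exp (-φ * Real.sqrt (x ^ 2 + y ^ 2 + d ^ 2)) <
      Real.exp (-φ * Real.sqrt (y ^ 2 + d ^ 2)) := by
    intro x y hx
    apply Real.exp_lt_exp.mpr
    have : Real.sqrt (y ^ 2 + d ^ 2) < Real.sqrt (x ^ 2 + y ^ 2 + d ^ 2) :=
      Real.sqrt_lt_sqrt (by positivity) (by nlinarith [pow_pos hx 2])
    nlinarith
  have hW : -(DW / 2) < DW / 2 := by linarith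
  have hL : -(DL / 2) < DL / 2 := by linarith
  have hG : Continuous (fun x : ℝ => ∫ y in (-(DW / 2))..(DW / 2),
      Real.exp (-φ * Real.sqrt (x ^ 2 + y ^ 2 + d ^ 2))) :=
    intervalIntegral.continuous_parametric_intervalIntegral_of_continuous' hc _ _
  have key : (∫ x in (-(DL / 2))..(DL / 2), ∫ y in (-(DW / 2))..(DW / 2),
        Real.exp (-φ * Real.sqrt (x ^ 2 + y ^ 2 + d ^ 2))) <
      ∫ _x in (-(DL / 2))..(DL / 2), ∫ y in (-(DW / 2))..(DW / 2),
        Real.exp (-φ * Real.sqrt (y ^ 2 + d ^ 2)) := by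
    apply intervalIntegral.integral_lt_integral_of_continuousOn_of_le_of_exists_lt hL
      hG.continuousOn continuousOn_const
    · intro x _
      exact intervalIntegral.integral_mono_on hW.le ((hcx x).intervalIntegrable _ _)
        (hc0.intervalIntegrable _ _) (fun y _ => hle x y)
    · refine ⟨DL / 2, ⟨hL.le, le_rfl⟩, ?_⟩
      exact intervalIntegral.integral_lt_integral_of_continuousOn_of_le_of_exists_lt hW
        (hcx _).continuousOn hc0.continuousOn (fun y _ => hle _ y)
        ⟨DW / 2, ⟨hW.le, le_rfl⟩, hlt _ _ (by linarith)⟩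
  rw [intervalIntegral.integral_const, smul_eq_mul,
    show DL / 2 - -(DL / 2) = DL by ring] at key
  have main : (1 / (DW * DL)) *
        (∫ x in (-(DL / 2))..(DL / 2), ∫ y in (-(DW / 2))..(DW / 2),
          Real.exp (-φ * Real.sqrt (x ^ 2 + y ^ 2 + d ^ 2))) <
      (1 / DW) * ∫ y in (-(DW / 2))..(DW / 2), Real.exp (-φ * Real.sqrt (y ^ 2 + d ^ 2)) := by
    have h := mul_lt_mul_of_pos_left key (show 0 < 1 / (DW * DL) by positivity)
    refine h.trans_eq ?_
    field_simp
  exact ⟨main, sub_lt_sub_left main 1⟩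
end

section
/- Fix φ > 0 and a ≥ 0 with a > 0 or restrict to the integrand e^{−φ√(x²+a)}. The function h(L) = (1/L)·∫₀^{L} e^{−φ·√(x² + a)} dx is strictly decreasing on (0, ∞). Consequently, the high-SNR outage-probability gap between the conventional-antenna and pinching-antenna systems is a strictly increasing function of the side length D_L of the service area. -/
open Real MeasureTheory intervalIntegral Set

theorem aux_anti (φ a : ℝ) (hφ : 0 < φ) (ha : 0 ≤ a) :
    StrictAntiOn
      (fun L : ℝ => (1 / L) * ∫ x in (0:ℝ)..L, Real.exp (-φ * Real.sqrt (x ^ 2 + a)))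
      (Set.Ioi 0) := by
  have key : ∀ L : ℝ, 0 < L →
      (1 / L) * ∫ x in (0:ℝ)..L, Real.exp (-φ * Real.sqrt (x ^ 2 + a)) =
      ∫ t in (0:ℝ)..1, Real.exp (-φ * Real.sqrt ((L * t) ^ 2 + a)) := by
    intro L hL
    have h := intervalIntegral.integral_comp_mul_left (a := 0) (b := 1)
      (fun x : ℝ => Real.exp (-φ * Real.sqrt (x ^ 2 + a))) hL.ne'
    simp only [mul_zero, mul_one, smul_eq_mul] at h
    rw [h, one_div]
  intro L hL M hM hLM
  have hL' : 0 < L := hL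
  have hM' : 0 < M := hM
  show (1 / M) * _ < (1 / L) * _
  rw [key L hL', key M hM']
  have lt : ∀ t : ℝ, 0 < t → Real.exp (-φ * Real.sqrt ((M * t) ^ 2 + a)) <
      Real.exp (-φ * Real.sqrt ((L * t) ^ 2 + a)) := by
    intro t ht
    apply Real.exp_lt_exp.2
    have h1 : L * t < M * t := by gcongr
    have h0 : 0 < L * t := by positivity
    have : Real.sqrt ((L * t) ^ 2 + a) < Real.sqrt ((M * t) ^ 2 + a) := by
      apply Real.sqrt_lt_sqrt (by positivity)
      gcongr
    nlinarith
  apply intervalIntegral.integral_lt_integral_of_continuousOn_of_le_of_exists_lt one_pos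
  · fun_prop
  · fun_prop
  · intro t ht
    exact (lt t ht.1).le
  · exact ⟨1, by simp, lt 1 one_pos⟩

/-- For fixed φ > 0 and a ≥ 0, the function
h(L) = (1/L)·∫₀^L e^{−φ√(x²+a)} dx is strictly decreasing on (0, ∞).
Consequently, the high-SNR outage-probability gap between the conventional-antenna
and the pinching-antenna systems is strictly increasing in the side length D_L. -/
theorem stmt_2 (φ a : ℝ) (hφ : 0 < φ) (ha : 0 ≤ a) :
    StrictAntiOn
      (fun L : ℝ => (1 / L) * ∫ x in (0:ℝ)..L, Real.exp (-φ * Real.sqrt (x ^ 2 + a)))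
      (Set.Ioi 0) ∧
    ∀ d DW : ℝ, 0 < d → 0 < DW →
      StrictMonoOn
        (fun DL : ℝ => (2 / DW) * ∫ y in (0:ℝ)..(DW / 2),
          (Real.exp (-φ * Real.sqrt (y ^ 2 + d ^ 2)) -
            (2 / DL) * ∫ x in (0:ℝ)..(DL / 2),
              Real.exp (-φ * Real.sqrt (x ^ 2 + y ^ 2 + d ^ 2))))
        (Set.Ioi 0) := by
  refine ⟨aux_anti φ a hφ ha, ?_⟩
  intro d DW hd hDW L hL M hM hLM
  have hL' : 0 < L := hL
  have hM' : 0 < M := hM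
  have lt : ∀ y : ℝ,
      (Real.exp (-φ * Real.sqrt (y ^ 2 + d ^ 2)) -
            (2 / L) * ∫ x in (0:ℝ)..(L / 2),
              Real.exp (-φ * Real.sqrt (x ^ 2 + y ^ 2 + d ^ 2))) <
      (Real.exp (-φ * Real.sqrt (y ^ 2 + d ^ 2)) -
            (2 / M) * ∫ x in (0:ℝ)..(M / 2),
              Real.exp (-φ * Real.sqrt (x ^ 2 + y ^ 2 + d ^ 2))) := by
    intro y
    have h := aux_anti φ (y ^ 2 + d ^ 2) hφ (by positivity)
      (show L / 2 ∈ Set.Ioi 0 from half_pos hL') (show M / 2 ∈ Set.Ioi 0 from half_pos hM')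
      (by linarith)
    simp only [one_div_div, ← add_assoc] at h
    linarith
  have cont : ∀ K : ℝ, Continuous (fun y : ℝ =>
      (Real.exp (-φ * Real.sqrt (y ^ 2 + d ^ 2)) -
            (2 / K) * ∫ x in (0:ℝ)..(K / 2),
              Real.exp (-φ * Real.sqrt (x ^ 2 + y ^ 2 + d ^ 2)))) := by
    intro K
    have : Continuous (fun y : ℝ => ∫ x in (0:ℝ)..(K / 2),
              Real.exp (-φ * Real.sqrt (x ^ 2 + y ^ 2 + d ^ 2))) := by
      apply intervalIntegral.continuous_parametric_intervalIntegral_of_continuous'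
      unfold Function.uncurry
      fun_prop
    fun_prop
  refine mul_lt_mul_of_pos_left ?_ (by positivity : 0 < 2 / DW)
  exact intervalIntegral.integral_lt_integral_of_continuousOn_of_le_of_exists_lt
    (half_pos hDW) (cont L).continuousOn (cont M).continuousOn
    (fun y _ => (lt y).le) ⟨0, ⟨le_rfl, (half_pos hDW).le⟩, lt 0⟩
end

section
/- For every φ > 0, d ≥ 0, D_W > 0 and D_L > 0, the double average (1/(D_W·D_L))·∫_{−D_L/2}^{D_L/2} ∫_{−D_W/2}^{D_W/2} (1 − e^{−φ·(x² + y² + d²)}) dy dx equals 1 − (π·e^{−φ d²}/(D_W·D_L·φ))·Φ(√φ·D_L/2)·Φ(√φ·D_W/2), where Φ denotes the error function. -/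
open Real MeasureTheory intervalIntegral

/-- The error function Φ(x) = (2/√π)·∫₀^x e^{−t²} dt. -/
noncomputable def erf (x : ℝ) : ℝ :=
  (2 / Real.sqrt Real.pi) * ∫ t in (0:ℝ)..x, Real.exp (-t ^ 2)

lemma gauss_aux (φ a : ℝ) (hφ : 0 < φ) :
    ∫ x in (-(a / 2))..(a / 2), Real.exp (-φ * x ^ 2)
      = Real.sqrt Real.pi / Real.sqrt φ * erf (Real.sqrt φ * a / 2) := by
  have hs : 0 < Real.sqrt φ := Real.sqrt_pos.mpr hφ
  have hp : 0 < Real.sqrt Real.pi := Real.sqrt_pos.mpr Real.pi_pos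
  have hint : ∀ u v : ℝ, IntervalIntegrable (fun x : ℝ => Real.exp (-φ * x ^ 2)) volume u v :=
    fun u v => (by fun_prop : Continuous fun x : ℝ => Real.exp (-φ * x ^ 2)).intervalIntegrable u v
  have h1 : ∫ x in (-(a / 2))..0, Real.exp (-φ * x ^ 2)
      = ∫ x in (0:ℝ)..(a / 2), Real.exp (-φ * x ^ 2) := by
    have := intervalIntegral.integral_comp_neg (a := 0) (b := a / 2)
      (fun x : ℝ => Real.exp (-φ * x ^ 2))
    simp only [neg_zero, neg_sq] at this
    exact this.symm
  have h2 : ∫ x in (0:ℝ)..(a / 2), Real.exp (-φ * x ^ 2)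
      = (Real.sqrt φ)⁻¹ * ∫ t in (0:ℝ)..(Real.sqrt φ * a / 2), Real.exp (-t ^ 2) := by
    have := intervalIntegral.integral_comp_mul_left (a := 0) (b := a / 2)
      (fun t : ℝ => Real.exp (-t ^ 2)) hs.ne'
    simp only [mul_zero, mul_pow, Real.sq_sqrt hφ.le, smul_eq_mul] at this
    rw [mul_div_assoc, ← this]
    simp only [neg_mul]
  rw [← intervalIntegral.integral_add_adjacent_intervals (hint _ 0) (hint 0 _), h1, h2, erf]
  field_simp
  ring

/-- closed form of the high-SNR outage probability of the conventional-antenna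
system under the ultra-dense blockage model. -/
theorem stmt_4 (φ d DW DL : ℝ) (hφ : 0 < φ) (hd : 0 ≤ d) (hDW : 0 < DW) (hDL : 0 < DL) :
    (1 / (DW * DL)) *
        ∫ x in (-(DL / 2))..(DL / 2), ∫ y in (-(DW / 2))..(DW / 2),
          (1 - Real.exp (-φ * (x ^ 2 + y ^ 2 + d ^ 2)))
      = 1 - (Real.pi * Real.exp (-φ * d ^ 2) / (DW * DL * φ)) *
          erf (Real.sqrt φ * DL / 2) * erf (Real.sqrt φ * DW / 2) := by
  have hs : 0 < Real.sqrt φ := Real.sqrt_pos.mpr hφ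
  have inner : ∀ x : ℝ, ∫ y in (-(DW / 2))..(DW / 2),
      (1 - Real.exp (-φ * (x ^ 2 + y ^ 2 + d ^ 2)))
      = DW - Real.exp (-φ * x ^ 2) * (Real.exp (-φ * d ^ 2) *
        (Real.sqrt Real.pi / Real.sqrt φ * erf (Real.sqrt φ * DW / 2))) := by
    intro x
    have e : ∀ y : ℝ, Real.exp (-φ * (x ^ 2 + y ^ 2 + d ^ 2))
        = (Real.exp (-φ * x ^ 2) * Real.exp (-φ * d ^ 2)) * Real.exp (-φ * y ^ 2) := by
      intro y
      rw [← Real.exp_add, ← Real.exp_add]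
      ring_nf
    simp only [e]
    rw [intervalIntegral.integral_sub (Continuous.intervalIntegrable (by fun_prop) _ _)
      (Continuous.intervalIntegrable (by fun_prop) _ _),
      intervalIntegral.integral_const_mul, gauss_aux φ DW hφ, intervalIntegral.integral_const]
    simp only [smul_eq_mul]
    ring
  simp only [inner]
  rw [intervalIntegral.integral_sub (Continuous.intervalIntegrable (by fun_prop) _ _)
      (Continuous.intervalIntegrable (by fun_prop) _ _),
      intervalIntegral.integral_mul_const, gauss_aux φ DL hφ, intervalIntegral.integral_const]
  simp only [smul_eq_mul]
  have k : Real.sqrt Real.pi / Real.sqrt φ * (Real.sqrt Real.pi / Real.sqrt φ) = Real.pi / φ := by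
    rw [div_mul_div_comm, Real.mul_self_sqrt Real.pi_pos.le, Real.mul_self_sqrt hφ.le]
  generalize Real.sqrt Real.pi / Real.sqrt φ = c at k ⊢
  have : Real.pi = c * c * φ := by rw [k]; field_simp
  rw [this]
  field_simp
  ring
end

section
/- For every φ > 0, d ≥ 0, D_W > 0 and D_L > 0, the following strict inequality holds: 1 − (√π·e^{−φ d²}/(√φ·D_W))·Φ(√φ·D_W/2) < 1 − (π·e^{−φ d²}/(D_W·D_L·φ))·Φ(√φ·D_L/2)·Φ(√φ·D_W/2), where Φ denotes the error function. That is, under the ultra-dense blockage model the high-SNR outage probability of the pinching-antenna system is strictly smaller than that of the conventional-antenna system. -/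
open Real MeasureTheory intervalIntegral

lemma erf_int_lt (x : ℝ) (hx : 0 < x) : ∫ t in (0:ℝ)..x, Real.exp (-t ^ 2) < x := by
  have h : ∫ t in (0:ℝ)..x, Real.exp (-t ^ 2) < ∫ t in (0:ℝ)..x, (1:ℝ) := by
    apply intervalIntegral.integral_lt_integral_of_continuousOn_of_le_of_exists_lt hx
    · fun_prop
    · fun_prop
    · intro t _
      rw [Real.exp_le_one_iff]
      nlinarith [sq_nonneg t]
    · refine ⟨x, ⟨hx.le, le_rfl⟩, ?_⟩
      rw [Real.exp_lt_one_iff]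
      have := pow_pos hx 2
      linarith
  simpa using h

lemma erf_pos_aux (x : ℝ) (hx : 0 < x) : 0 < erf x := by
  unfold erf
  have : 0 < ∫ t in (0:ℝ)..x, Real.exp (-t ^ 2) := by
    apply intervalIntegral.intervalIntegral_pos_of_pos
    · apply Continuous.intervalIntegrable
      fun_prop
    · intro t
      positivity
    · exact hx
  have := Real.pi_pos
  positivity

/-- under the ultra-dense blockage model, the high-SNR outage probability of the
pinching-antenna system is strictly smaller than that of the conventional-antenna system. -/
theorem stmt_6 (φ d DW DL : ℝ) (hφ : 0 < φ) (hd : 0 ≤ d) (hDW : 0 < DW) (hDL : 0 < DL) :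
    1 - (Real.sqrt Real.pi * Real.exp (-φ * d ^ 2) / (Real.sqrt φ * DW)) *
        erf (Real.sqrt φ * DW / 2) <
      1 - (Real.pi * Real.exp (-φ * d ^ 2) / (DW * DL * φ)) *
        erf (Real.sqrt φ * DL / 2) * erf (Real.sqrt φ * DW / 2) := by
  have hs : 0 < √φ := Real.sqrt_pos.2 hφ
  have hp : 0 < √π := Real.sqrt_pos.2 Real.pi_pos
  have hss : √φ * √φ = φ := Real.mul_self_sqrt hφ.le
  have hpp : √π * √π = π := Real.mul_self_sqrt Real.pi_pos.le
  have hW := erf_pos_aux (√φ * DW / 2) (by positivity)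
  have hL := erf_int_lt (√φ * DL / 2) (by positivity)
  have hE : √π * erf (√φ * DL / 2) < √φ * DL := by
    unfold erf
    rw [← mul_assoc, mul_div_cancel₀ _ hp.ne']
    linarith
  apply sub_lt_sub_left
  apply mul_lt_mul_of_pos_right _ hW
  have key : π * Real.exp (-φ * d ^ 2) / (DW * DL * φ) * erf (√φ * DL / 2)
      = (√π * Real.exp (-φ * d ^ 2) / (√φ * DW)) *
        ((√π * erf (√φ * DL / 2)) / (√φ * DL)) := by
    generalize erf (√φ * DL / 2) = e
    generalize Real.exp (-φ * d ^ 2) = y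
    rw [div_mul_eq_mul_div, div_mul_div_comm]
    congr 1
    · linear_combination (-y * e) * hpp
    · linear_combination (-DW * DL) * hss
  rw [key]
  apply mul_lt_of_lt_one_right (by positivity)
  rw [div_lt_one (by positivity)]
  exact hE
end

section
/- For every φ > 0, L > 0 and τ ∈ ℝ, ∫_{−L}^{L} (1 − e^{−φ·(z² + τ)})·((L − |z|)/L²) dz = 2·(1/2 − e^{−φ τ}·(√π/(2·√φ·L))·Φ(√φ·L) + (e^{−φ τ}/(2·φ·L²))·(1 − e^{−φ·L²})), where Φ denotes the error function. -/
open Real MeasureTheory intervalIntegral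

/-- the blockage-probability average against the triangular density
(Lemma 3 closed form). -/
theorem stmt_10 (φ L τ : ℝ) (hφ : 0 < φ) (hL : 0 < L) :
    ∫ z in (-L)..L, (1 - Real.exp (-φ * (z ^ 2 + τ))) * ((L - |z|) / L ^ 2)
      = 2 * (1 / 2
          - Real.exp (-φ * τ) * (Real.sqrt Real.pi / (2 * Real.sqrt φ * L)) *
              erf (Real.sqrt φ * L)
          + (Real.exp (-φ * τ) / (2 * φ * L ^ 2)) * (1 - Real.exp (-φ * L ^ 2))) := by
  have hs : 0 < Real.sqrt φ := Real.sqrt_pos.mpr hφ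
  have hs2 : Real.sqrt φ ^ 2 = φ := Real.sq_sqrt hφ.le
  have hpi : 0 < Real.sqrt Real.pi := Real.sqrt_pos.mpr Real.pi_pos
  have hcont : Continuous (fun t : ℝ => Real.exp (-t ^ 2)) := by fun_prop
  have hfc : Continuous (fun z : ℝ =>
      (1 - Real.exp (-φ * (z ^ 2 + τ))) * ((L - |z|) / L ^ 2)) := by fun_prop
  have hG : ∀ x : ℝ, HasDerivAt (fun x => ∫ t in (0:ℝ)..x, Real.exp (-t ^ 2))
      (Real.exp (-x ^ 2)) x := fun x => 
    integral_hasDerivAt_right (hcont.intervalIntegrable _ _)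
      (hcont.stronglyMeasurableAtFilter _ _) hcont.continuousAt
  have hhalf : ∫ z in (0:ℝ)..L, (1 - Real.exp (-φ * (z ^ 2 + τ))) * ((L - |z|) / L ^ 2)
      = 1 / 2 - Real.exp (-φ * τ) / L ^ 2 * (L / Real.sqrt φ *
          (∫ t in (0:ℝ)..(Real.sqrt φ * L), Real.exp (-t ^ 2))
          + Real.exp (-φ * L ^ 2) / (2 * φ) - 1 / (2 * φ)) := by
    have hF : ∀ z ∈ Set.uIcc 0 L, HasDerivAt (fun z : ℝ =>
        (L * z - z ^ 2 / 2) / L ^ 2 - Real.exp (-φ * τ) / L ^ 2 * (L / Real.sqrt φ *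
          (∫ t in (0:ℝ)..(Real.sqrt φ * z), Real.exp (-t ^ 2))
          + Real.exp (-φ * z ^ 2) / (2 * φ)))
        ((1 - Real.exp (-φ * (z ^ 2 + τ))) * ((L - |z|) / L ^ 2)) z := by
      intro z hz
      rw [Set.uIcc_of_le hL.le] at hz
      have h1 : HasDerivAt (fun z : ℝ => Real.sqrt φ * z) (Real.sqrt φ) z := by
        simpa using (hasDerivAt_id z).const_mul (Real.sqrt φ)
      have h2 := (hG (Real.sqrt φ * z)).comp z h1
      have hsq : HasDerivAt (fun z : ℝ => z ^ 2) (2 * z) z := by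
        simpa using hasDerivAt_pow 2 z
      have h3 := ((hsq.const_mul (-φ)).exp).div_const (2 * φ)
      have hl : HasDerivAt (fun z : ℝ => L * z) L z := by
        simpa using (hasDerivAt_id z).const_mul L
      have h4 := (hl.sub (hsq.div_const 2)).div_const (L ^ 2)
      have h5 := h4.sub (((h2.const_mul (L / Real.sqrt φ)).add h3).const_mul
        (Real.exp (-φ * τ) / L ^ 2))
      refine h5.congr_deriv ?_
      have e1 : Real.exp (-(Real.sqrt φ * z) ^ 2) = Real.exp (-φ * z ^ 2) := by
        rw [mul_pow, hs2, neg_mul]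
      rw [e1, abs_of_nonneg hz.1, mul_add (-φ) (z ^ 2) τ, Real.exp_add]
      generalize Real.exp (-φ * z ^ 2) = A
      generalize Real.exp (-φ * τ) = B
      field_simp
      ring
    rw [integral_eq_sub_of_hasDerivAt hF (hfc.intervalIntegrable _ _)]
    simp
    field_simp
    ring
  have hsymm : ∫ z in (-L)..0, (1 - Real.exp (-φ * (z ^ 2 + τ))) * ((L - |z|) / L ^ 2)
      = ∫ z in (0:ℝ)..L, (1 - Real.exp (-φ * (z ^ 2 + τ))) * ((L - |z|) / L ^ 2) := by
    have := intervalIntegral.integral_comp_neg (a := 0) (b := L) (fun z : ℝ =>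
      (1 - Real.exp (-φ * (z ^ 2 + τ))) * ((L - |z|) / L ^ 2))
    simpa using this.symm
  rw [← integral_add_adjacent_intervals (hfc.intervalIntegrable (-L) 0)
    (hfc.intervalIntegrable 0 L), hsymm, hhalf, erf]
  field_simp
  ring
end

section
/- For every φ > 0, L > 0 and τ > 0, the quantity 1/2 − e^{−φ τ}·(√π/(2·√φ·L))·Φ(√φ·L) + (e^{−φ τ}/(2·φ·L²))·(1 − e^{−φ·L²}) is strictly positive, where Φ denotes the error function. -/
open Real MeasureTheory intervalIntegral

theorem aux_bound (a : ℝ) (ha : 0 < a) :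
    2 * a * (∫ t in (0:ℝ)..a, Real.exp (-t ^ 2)) - (1 - Real.exp (-a ^ 2)) ≤ a ^ 2 := by
  have h1 : ∫ t in (0:ℝ)..a, (2 * t * Real.exp (-t ^ 2)) = 1 - Real.exp (-a ^ 2) := by
    have := intervalIntegral.integral_eq_sub_of_hasDerivAt (a := 0) (b := a)
      (f := fun t : ℝ => - Real.exp (-t ^ 2)) (f' := fun t => 2 * t * Real.exp (-t ^ 2))
      (fun t _ => by
        have h := (((hasDerivAt_id t).pow 2).neg.exp).neg
        convert h using 1
        · rfl
        · simp
          ring)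
      (Continuous.intervalIntegrable (by fun_prop) _ _)
    rw [this]
    simp
    ring
  have h2 : ∫ t in (0:ℝ)..a, (2 * a - 2 * t) = a ^ 2 := by
    rw [intervalIntegral.integral_sub (by simp) (Continuous.intervalIntegrable (by fun_prop) _ _),
      intervalIntegral.integral_const_mul, intervalIntegral.integral_const_mul, integral_id]
    simp
    ring
  rw [← h1, ← h2, ← intervalIntegral.integral_const_mul, ← intervalIntegral.integral_sub
    (Continuous.intervalIntegrable (by fun_prop) _ _)
    (Continuous.intervalIntegrable (by fun_prop) _ _)]
  apply intervalIntegral.integral_mono_on ha.le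
    (Continuous.intervalIntegrable (by fun_prop) _ _)
    (Continuous.intervalIntegrable (by fun_prop) _ _)
  intro t ht
  have h3 : Real.exp (-t ^ 2) ≤ 1 := Real.exp_le_one_iff.mpr (by nlinarith [sq_nonneg t])
  nlinarith [ht.2]

/-- the bracketed multiplicative factor in the high-SNR ergodic rate of the
two-user pinching-antenna system (Lemma 3) is strictly positive. -/
theorem stmt_11 (φ L τ : ℝ) (hφ : 0 < φ) (hL : 0 < L) (hτ : 0 < τ) :
    0 < 1 / 2
        - Real.exp (-φ * τ) * (Real.sqrt Real.pi / (2 * Real.sqrt φ * L)) *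
            erf (Real.sqrt φ * L)
        + (Real.exp (-φ * τ) / (2 * φ * L ^ 2)) * (1 - Real.exp (-φ * L ^ 2)) := by
  have hs : 0 < Real.sqrt φ := Real.sqrt_pos.mpr hφ
  have ha : 0 < Real.sqrt φ * L := mul_pos hs hL
  have hsq : (Real.sqrt φ * L) ^ 2 = φ * L ^ 2 := by rw [mul_pow, Real.sq_sqrt hφ.le]
  have hb := aux_bound _ ha
  have hE : Real.exp (-φ * τ) < 1 := Real.exp_lt_one_iff.mpr (by nlinarith [mul_pos hφ hτ])
  have hE0 := Real.exp_pos (-φ * τ)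
  have hpi : 0 < Real.sqrt Real.pi := Real.sqrt_pos.mpr Real.pi_pos
  have e1 : -φ * L ^ 2 = -(Real.sqrt φ * L) ^ 2 := by rw [hsq]; ring
  have e2 : 2 * φ * L ^ 2 = 2 * (Real.sqrt φ * L) ^ 2 := by rw [hsq]; ring
  have e3 : 2 * Real.sqrt φ * L = 2 * (Real.sqrt φ * L) := by ring
  unfold erf
  rw [e1, e2, e3]
  generalize Real.sqrt φ * L = a at *
  generalize (∫ t in (0:ℝ)..a, Real.exp (-t ^ 2)) = I at *
  generalize Real.exp (-φ * τ) = E at *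
  generalize Real.exp (-a ^ 2) = X at *
  generalize Real.sqrt Real.pi = p at *
  have key : 1 / 2 - E * (p / (2 * a)) * (2 / p * I) + E / (2 * a ^ 2) * (1 - X)
      = (a ^ 2 - E * (2 * a * I - (1 - X))) / (2 * a ^ 2) := by
    field_simp
    ring
  rw [key]
  apply div_pos _ (by positivity)
  nlinarith [mul_le_mul_of_nonneg_left hb hE0.le, mul_pos (sub_pos.mpr hE) (pow_pos ha 2)]
end

section
/- Let φ > 0, D_W > 0, d > 0, τ₁ ≥ d, and set τ₂ = max{−D_W/2, −√(τ₁² − d²)} and τ₃ = min{D_W/2, √(τ₁² − d²)}. For Y uniform on [−D_W/2, D_W/2] and, conditionally on Y = y, α Bernoulli with P(α = 1 | Y = y) = e^{−φ·√(y² + d²)}, the outage probability satisfies P( α = 0 or √(Y² + d²) ≥ τ₁ ) = 1 − f(−D_W/2, D_W/2) + f(−D_W/2, τ₂) + f(τ₃, D_W/2), where f(a, b) = (1/D_W)·∫_a^b e^{−φ·√(y² + d²)} dy. -/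
open Real MeasureTheory intervalIntegral

/-- exact single-user outage probability of the pinching-antenna system
under the blockage model e^{−φr}: with τ₂ = max{−D_W/2, −√(τ₁²−d²)} and
τ₃ = min{D_W/2, √(τ₁²−d²)}, it equals 1 − f(−D_W/2, D_W/2) + f(−D_W/2, τ₂) + f(τ₃, D_W/2)
where f(a,b) = (1/D_W)·∫_a^b e^{−φ√(y²+d²)} dy. -/
theorem stmt_14 {Ω : Type*} [MeasurableSpace Ω] (μ : Measure Ω) [IsProbabilityMeasure μ]
    (φ DW d τ₁ : ℝ) (hφ : 0 < φ) (hDW : 0 < DW) (hd : 0 < d) (hτ₁ : d ≤ τ₁)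
    (τ₂ τ₃ : ℝ) (hτ₂ : τ₂ = max (-(DW / 2)) (-Real.sqrt (τ₁ ^ 2 - d ^ 2)))
    (hτ₃ : τ₃ = min (DW / 2) (Real.sqrt (τ₁ ^ 2 - d ^ 2)))
    (f : ℝ → ℝ → ℝ)
    (hf : ∀ a b : ℝ, f a b = (1 / DW) * ∫ y in a..b, Real.exp (-φ * Real.sqrt (y ^ 2 + d ^ 2)))
    (Y : Ω → ℝ) (α : Ω → Bool) (hY : Measurable Y) (hα : Measurable α)
    (hlaw : Measure.map Y μ =
      (ENNReal.ofReal (1 / DW)) • volume.restrict (Set.Icc (-(DW / 2)) (DW / 2)))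
    (hcond : ∀ B : Set ℝ, MeasurableSet B →
      μ {ω | α ω = true ∧ Y ω ∈ B} =
        ∫⁻ y in B, ENNReal.ofReal (Real.exp (-φ * Real.sqrt (y ^ 2 + d ^ 2)))
          ∂((ENNReal.ofReal (1 / DW)) • volume.restrict (Set.Icc (-(DW / 2)) (DW / 2)))) :
    μ {ω | α ω = false ∨ τ₁ ≤ Real.sqrt ((Y ω) ^ 2 + d ^ 2)} =
      ENNReal.ofReal (1 - f (-(DW / 2)) (DW / 2) + f (-(DW / 2)) τ₂ + f τ₃ (DW / 2)) := by
  have hcont : Continuous (fun y : ℝ => Real.exp (-φ * Real.sqrt (y ^ 2 + d ^ 2))) := by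
    fun_prop
  set s := Real.sqrt (τ₁ ^ 2 - d ^ 2) with hs
  have hs0 : 0 ≤ s := Real.sqrt_nonneg _
  have hs2 : s ^ 2 = τ₁ ^ 2 - d ^ 2 := Real.sq_sqrt (by nlinarith)
  have hle : τ₂ ≤ τ₃ := by
    rw [hτ₂, hτ₃]
    apply max_le <;> apply le_min <;> linarith
  have hmeas : MeasurableSet {ω | α ω = true ∧ Y ω ∈ Set.Ioo (-s) s} :=
    (hα (measurableSet_singleton true)).inter (hY measurableSet_Ioo)
  have hset : {ω | α ω = false ∨ τ₁ ≤ Real.sqrt ((Y ω) ^ 2 + d ^ 2)} =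
      {ω | α ω = true ∧ Y ω ∈ Set.Ioo (-s) s}ᶜ := by
    ext ω
    have key : τ₁ ≤ Real.sqrt ((Y ω) ^ 2 + d ^ 2) ↔ ¬ (Y ω ∈ Set.Ioo (-s) s) := by
      rw [Set.mem_Ioo, ← abs_lt, not_lt, Real.le_sqrt' (by linarith), ← abs_of_nonneg hs0,
        ← sq_le_sq, hs2]
      constructor <;> intro h <;> linarith
    simp only [Set.mem_ofPred_eq, Set.mem_compl_iff, key]
    cases α ω <;> simp
  have hint : μ {ω | α ω = true ∧ Y ω ∈ Set.Ioo (-s) s} = ENNReal.ofReal (f τ₂ τ₃) := by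
    rw [hcond _ measurableSet_Ioo, Measure.restrict_smul, lintegral_smul_measure,
      Measure.restrict_restrict measurableSet_Ioo]
    have hae : (Set.Ioo (-s) s ∩ Set.Icc (-(DW / 2)) (DW / 2) : Set ℝ) =ᵐ[volume]
        Set.Ioc τ₂ τ₃ := by
      have h := (Ioo_ae_eq_Ioc (μ := (volume : Measure ℝ)) (a := -s) (b := s)).inter
        (Ioc_ae_eq_Icc (μ := (volume : Measure ℝ)) (a := -(DW / 2)) (b := DW / 2)).symm
      rw [Set.Ioc_inter_Ioc] at h
      rw [hτ₂, hτ₃, max_comm, min_comm]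
      exact h
    rw [Measure.restrict_congr_set hae, hf, ENNReal.ofReal_mul (by positivity),
      intervalIntegral.integral_of_le hle, ofReal_integral_eq_lintegral_ofReal, smul_eq_mul]
    · exact hcont.integrableOn_Ioc
    · exact Filter.Eventually.of_forall fun y => (Real.exp_pos _).le
  have hf0 : 0 ≤ f τ₂ τ₃ := by
    rw [hf]
    exact mul_nonneg (by positivity)
      (intervalIntegral.integral_nonneg hle fun y _ => (Real.exp_pos _).le)
  have hii : ∀ a b : ℝ, IntervalIntegrable
      (fun y : ℝ => Real.exp (-φ * Real.sqrt (y ^ 2 + d ^ 2))) volume a b :=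
    fun a b => hcont.intervalIntegrable a b
  have hadd : f (-(DW / 2)) (DW / 2) = f (-(DW / 2)) τ₂ + f τ₂ τ₃ + f τ₃ (DW / 2) := by
    simp only [hf]
    rw [← mul_add, ← mul_add, intervalIntegral.integral_add_adjacent_intervals (hii _ _) (hii _ _),
      intervalIntegral.integral_add_adjacent_intervals (hii _ _) (hii _ _)]
  rw [hset, prob_compl_eq_one_sub hmeas, hint, hadd, ← ENNReal.ofReal_one,
    ← ENNReal.ofReal_sub _ hf0]
  congr 1
  ring
end

section
/- For every φ > 0 and c ≥ 0, the function L ↦ (2/L)·∫₀^{L/2} e^{−φ·(x² + c)} dx is strictly decreasing on (0, ∞), and it tends to 0 as L → ∞; consequently, under the ultra-dense blockage model the high-SNR outage gap γ₁·(1 − (√π/(D_L√φ))·Φ(√φ D_L/2)) converges to γ₁ as D_L → ∞. -/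
open Real MeasureTheory intervalIntegral Filter

/-- for φ > 0 and c ≥ 0, L ↦ (2/L)·∫₀^{L/2} e^{−φ(x²+c)} dx is strictly
decreasing on (0,∞) and tends to 0 as L → ∞; consequently the high-SNR outage gap
γ₁·(1 − (√π/(D_L√φ))·Φ(√φ D_L/2)) converges to γ₁ as D_L → ∞. -/
theorem stmt_16 (φ c : ℝ) (hφ : 0 < φ) (hc : 0 ≤ c) :
    StrictAntiOn
      (fun L : ℝ => (2 / L) * ∫ x in (0:ℝ)..(L / 2), Real.exp (-φ * (x ^ 2 + c)))
      (Set.Ioi 0) ∧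
    Tendsto
      (fun L : ℝ => (2 / L) * ∫ x in (0:ℝ)..(L / 2), Real.exp (-φ * (x ^ 2 + c)))
      atTop (nhds 0) ∧
    ∀ d DW : ℝ, 0 ≤ d → 0 < DW →
      Tendsto
        (fun DL : ℝ =>
          ((Real.sqrt Real.pi * Real.exp (-φ * d ^ 2) / (Real.sqrt φ * DW)) *
              erf (Real.sqrt φ * DW / 2)) *
            (1 - (Real.sqrt Real.pi / (DL * Real.sqrt φ)) * erf (Real.sqrt φ * DL / 2)))
        atTop
        (nhds ((Real.sqrt Real.pi * Real.exp (-φ * d ^ 2) / (Real.sqrt φ * DW)) *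
          erf (Real.sqrt φ * DW / 2))) := by
  have hint : ∀ b : ℝ, 0 < b → ∀ k : ℝ, Tendsto
      (fun X : ℝ => ∫ x in (0:ℝ)..X, Real.exp (-b * (x ^ 2 + k))) atTop
      (nhds (∫ x in Set.Ioi (0:ℝ), Real.exp (-b * (x ^ 2 + k)))) := by
    intro b hb k
    refine intervalIntegral_tendsto_integral_Ioi 0 ?_ tendsto_id
    have h : (fun x : ℝ => Real.exp (-b * (x ^ 2 + k)))
        = fun x => Real.exp (-b * x ^ 2) * Real.exp (-b * k) := by
      funext x
      rw [← Real.exp_add]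
      ring_nf
    rw [h]
    exact ((integrable_exp_neg_mul_sq hb).mul_const _).integrableOn
  refine ⟨?_, ?_, ?_⟩
  · have key : ∀ L : ℝ, 0 < L →
        (2 / L) * ∫ x in (0:ℝ)..(L / 2), Real.exp (-φ * (x ^ 2 + c))
          = ∫ t in (0:ℝ)..1, Real.exp (-φ * ((L / 2 * t) ^ 2 + c)) := by
      intro L hL
      rw [intervalIntegral.integral_comp_mul_left
        (fun x => Real.exp (-φ * (x ^ 2 + c))) (by positivity : L / 2 ≠ 0)]
      simp
    intro a ha b hb hab
    simp only [Set.mem_Ioi] at ha hb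
    have hlt : ∀ t : ℝ, 0 < t → Real.exp (-φ * ((b / 2 * t) ^ 2 + c)) <
        Real.exp (-φ * ((a / 2 * t) ^ 2 + c)) := by
      intro t ht
      have h1 : (a / 2 * t) ^ 2 < (b / 2 * t) ^ 2 := by gcongr
      apply Real.exp_lt_exp.2
      nlinarith
    show (2 / b) * _ < (2 / a) * _
    rw [key a ha, key b hb]
    refine intervalIntegral.integral_lt_integral_of_continuousOn_of_le_of_exists_lt
      one_pos (by fun_prop) (by fun_prop) (fun t ht => (hlt t ht.1).le)
      ⟨1, by simp, hlt 1 one_pos⟩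
  · have h1 : Tendsto (fun L : ℝ => 2 / L) atTop (nhds 0) :=
      tendsto_const_nhds.div_atTop tendsto_id
    have h2 := (hint φ hφ c).comp (tendsto_id.atTop_div_const (two_pos : (0:ℝ) < 2))
    simpa using h1.mul h2
  · intro d DW hd hDW
    have hs : 0 < Real.sqrt φ := Real.sqrt_pos.2 hφ
    have h1 : Tendsto (fun L : ℝ => Real.sqrt Real.pi / (L * Real.sqrt φ)) atTop (nhds 0) :=
      tendsto_const_nhds.div_atTop (tendsto_id.atTop_mul_const hs)
    have h2 := (hint 1 one_pos 0).comp
      ((tendsto_id.const_mul_atTop hs).atTop_div_const (two_pos : (0:ℝ) < 2))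
    have h3 := h1.mul (h2.const_mul (2 / Real.sqrt Real.pi))
    have h4 : Tendsto (fun DL : ℝ => (Real.sqrt Real.pi / (DL * Real.sqrt φ)) *
        erf (Real.sqrt φ * DL / 2)) atTop (nhds 0) := by
      rw [zero_mul] at h3
      refine h3.congr fun L => ?_
      simp [erf]
    simpa only [sub_zero, mul_one] using (h4.const_sub 1).const_mul
      ((Real.sqrt Real.pi * Real.exp (-φ * d ^ 2) / (Real.sqrt φ * DW)) *
              erf (Real.sqrt φ * DW / 2))
end
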